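/- Let N_T, N_S be integers with 1 ≤ N_S < N_T, let μ_1, μ_2 > 0, set μ_Σ = μ_1μ_2/(μ_1+μ_2), and let s > 0. Define Φ_{(ξ)}(y) = ∑_{n=ξ}^{N_T} C(N_T,n)(1 − e^{−y/μ_Σ})^n (e^{−y/μ_Σ})^{N_T−n}, and for t > 0 define P̄_o(t) = 2^{−N_S}·{ Φ_{(N_T−N_S)}(s/t) + ∑_{w=1}^{N_S} C(N_S,w) ∑_{ξ=N_T−N_S+1}^{N_T−w+1} [C(N_T−ξ, w−1)/C(N_S,w)] Φ_{(ξ)}(s w/t) }. Then lim_{t → ∞} t^{N_T−N_S} · P̄_o(t) = [C(N_T, N_T−N_S)/2^{N_S}] · (s/μ_Σ)^{N_T−N_S}. -/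

import Mathlib

open Filter Topology

/-- The CDF of the `ξ`-th smallest order statistic of `N_T` i.i.d. exponentials with mean `μ`. -/
noncomputable def FOrd (NT ξ : ℕ) (μ y : ℝ) : ℝ :=
  ∑ n ∈ Finset.Icc ξ NT,
    (NT.choose n : ℝ) * (1 - Real.exp (-y / μ)) ^ n * Real.exp (-y / μ) ^ (NT - n)

/-- The exact average outage probability for the centralized mapping scheme selection,
with merged-link mean `μ_Σ = μ₁μ₂/(μ₁+μ₂)`. -/
noncomputable def PoutC (NT NS : ℕ) (muS s t : ℝ) : ℝ :=
  (1 / 2 ^ NS) *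
    (FOrd NT (NT - NS) muS (s / t)
      + ∑ w ∈ Finset.Icc 1 NS, (NS.choose w : ℝ) *
          ∑ ξ ∈ Finset.Icc (NT - NS + 1) (NT - w + 1),
            ((NT - ξ).choose (w - 1) : ℝ) / (NS.choose w : ℝ) * FOrd NT ξ muS (s * w / t))

/-- First-order behaviour at the origin of the exponential CDF. -/
theorem tendsto_mul_one_sub_exp_neg_div (μ c : ℝ) :
    Tendsto (fun t : ℝ => t * (1 - Real.exp (-(c / t) / μ))) atTop (𝓝 (c / μ)) := by
  have hd : HasDerivAt (fun x : ℝ => 1 - Real.exp (-(c * x) / μ)) (c / μ) 0 := by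
    have h : HasDerivAt (fun x : ℝ => 1 - Real.exp (-(c * x) / μ))
        (-(Real.exp (-(c * 0) / μ) * (-(c * 1) / μ))) 0 :=
      ((((hasDerivAt_id (0 : ℝ)).const_mul c).neg.div_const μ).exp).const_sub 1
    simpa [neg_div] using h
  have h := (hasDerivAt_iff_tendsto_slope_zero.mp hd).comp
    (tendsto_inv_atTop_nhdsGT_zero.mono_right
      (nhdsWithin_mono (0 : ℝ) fun _ hx => ne_of_gt hx))
  refine h.congr fun t => ?_
  simp [div_eq_mul_inv]

theorem tendsto_exp_neg_div_atTop (μ c : ℝ) :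
    Tendsto (fun t : ℝ => Real.exp (-(c / t) / μ)) atTop (𝓝 1) := by
  have h := ((tendsto_const_nhds (x := c)).div_atTop tendsto_id).neg.div_const μ
  simpa using h.rexp

theorem tendsto_pow_mul_FOrd (NT k ξ : ℕ) (hk : k ≤ ξ) (μ c : ℝ) :
    Tendsto (fun t : ℝ => t ^ k * FOrd NT ξ μ (c / t)) atTop
      (𝓝 (∑ n ∈ Finset.Icc ξ NT, (NT.choose n : ℝ) * (c / μ) ^ k * 0 ^ (n - k))) := by
  simp only [FOrd, Finset.mul_sum]
  refine tendsto_finsetSum _ fun n hn => ?_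
  have hkn : k ≤ n := hk.trans (Finset.mem_Icc.mp hn).1
  have hE := tendsto_exp_neg_div_atTop μ c
  have h := (((tendsto_mul_one_sub_exp_neg_div μ c).pow k).const_mul (NT.choose n : ℝ)).mul
    ((hE.const_sub 1).pow (n - k)) |>.mul (hE.pow (NT - n))
  simp only [sub_self, one_pow, mul_one] at h
  refine h.congr fun t => ?_
  obtain ⟨m, rfl⟩ := Nat.exists_eq_add_of_le hkn
  rw [Nat.add_sub_cancel_left, mul_pow, pow_add]
  ring

theorem tendsto_pow_mul_FOrd_self (NT k : ℕ) (hk : k ≤ NT) (μ c : ℝ) :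
    Tendsto (fun t : ℝ => t ^ k * FOrd NT k μ (c / t)) atTop
      (𝓝 ((NT.choose k : ℝ) * (c / μ) ^ k)) := by
  convert tendsto_pow_mul_FOrd NT k k le_rfl μ c using 2
  rw [Finset.sum_eq_single_of_mem k (Finset.mem_Icc.mpr ⟨le_rfl, hk⟩)]
  · simp
  · intro n hn hne
    have := (Finset.mem_Icc.mp hn).1
    rw [zero_pow (by lia), mul_zero]

theorem tendsto_pow_mul_FOrd_of_lt (NT k ξ : ℕ) (hk : k < ξ) (μ c : ℝ) :
    Tendsto (fun t : ℝ => t ^ k * FOrd NT ξ μ (c / t)) atTop (𝓝 0) := by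
  convert tendsto_pow_mul_FOrd NT k ξ hk.le μ c using 2
  refine (Finset.sum_eq_zero fun n hn => ?_).symm
  have := (Finset.mem_Icc.mp hn).1
  rw [zero_pow (by lia), mul_zero]

/-- High-SNR asymptotics of the centralized average outage probability:
`lim_{t→∞} t^{N_T−N_S}·P̄_o(t) = [C(N_T,N_T−N_S)/2^{N_S}]·(s/μ_Σ)^{N_T−N_S}`. -/
theorem stmt_9 (NT NS : ℕ) (hNS : 1 ≤ NS) (hNT : NS < NT)
    (μ₁ μ₂ s : ℝ) (hμ₁ : 0 < μ₁) (hμ₂ : 0 < μ₂) (hs : 0 < s) :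
    Tendsto
      (fun t : ℝ => t ^ (NT - NS) * PoutC NT NS (μ₁ * μ₂ / (μ₁ + μ₂)) s t) atTop
      (nhds ((NT.choose (NT - NS) : ℝ) / 2 ^ NS
        * (s / (μ₁ * μ₂ / (μ₁ + μ₂))) ^ (NT - NS))) := by
  set muS := μ₁ * μ₂ / (μ₁ + μ₂)
  have hsum : Tendsto (fun t : ℝ => ∑ w ∈ Finset.Icc 1 NS, (NS.choose w : ℝ) *
      ∑ ξ ∈ Finset.Icc (NT - NS + 1) (NT - w + 1),
        ((NT - ξ).choose (w - 1) : ℝ) / (NS.choose w : ℝ) *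
          (t ^ (NT - NS) * FOrd NT ξ muS (s * w / t))) atTop
      (𝓝 (∑ w ∈ Finset.Icc 1 NS, (NS.choose w : ℝ) *
        ∑ ξ ∈ Finset.Icc (NT - NS + 1) (NT - w + 1),
          ((NT - ξ).choose (w - 1) : ℝ) / (NS.choose w : ℝ) * 0)) :=
    tendsto_finsetSum _ fun w _ => (tendsto_finsetSum _ fun ξ hξ =>
      (tendsto_pow_mul_FOrd_of_lt NT (NT - NS) ξ (Finset.mem_Icc.mp hξ).1 muS
        (s * w)).const_mul _).const_mul _
  have h := ((tendsto_pow_mul_FOrd_self NT (NT - NS) (Nat.sub_le NT NS) muS s).add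
    hsum).const_mul (1 / 2 ^ NS : ℝ)
  simp only [mul_zero, Finset.sum_const_zero, add_zero] at h
  convert h using 2 with t
  · simp only [PoutC, mul_left_comm _ (t ^ (NT - NS)), ← Finset.mul_sum, ← mul_add]
  · ring
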